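/- Let d = 5 and let S be the swap unitary on ℂ⁵ ⊗ ℂ⁵ (S(u ⊗ v) = v ⊗ u). There exist a two-qudit Clifford unitary C ∈ C_5^2 and one-qudit Clifford unitaries C₁, C₂ ∈ C_5^1 such that S C = C (C₁ ⊗ C₂). In other words, left multiplication by the swap gate fixes the left coset C·(C_5^1 ⊗ C_5^1) of the local Clifford subgroup in the two-qudit Clifford group. -/

import Mathlib

open Matrix Complex
open scoped Kronecker BigOperators ComplexOrder

noncomputable section

/-- `ω = exp(2πi/d)`. -/
def omega (d : ℕ) : ℂ := Complex.exp (2 * Real.pi * Complex.I / d)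

/-- The generalized Pauli `X` matrix on `ℂ^d`: `X = ∑_j |j⟩⟨j ⊕ 1|`. -/
def Xmat (d : ℕ) : Matrix (ZMod d) (ZMod d) ℂ :=
  Matrix.of fun j k => if k = j + 1 then 1 else 0

/-- The generalized Pauli `Z` matrix on `ℂ^d`: `Z = ∑_j ω^j |j⟩⟨j|`. -/
def Zmat (d : ℕ) : Matrix (ZMod d) (ZMod d) ℂ :=
  Matrix.of fun j k => if j = k then omega d ^ j.val else 0

variable (d : ℕ) [NeZero d]

/-- `P_{r,s} = X^r Z^s`. -/
def Pauli (r s : ZMod d) : Matrix (ZMod d) (ZMod d) ℂ :=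
  Xmat d ^ r.val * Zmat d ^ s.val

/-- Phase-free two-qudit Pauli operator `P_{r,s} ⊗ P_{r',s'}`. -/
def Pauli2 (r s r' s' : ZMod d) :
    Matrix (ZMod d × ZMod d) (ZMod d × ZMod d) ℂ :=
  Pauli d r s ⊗ₖ Pauli d r' s'

/-- The one-qudit Pauli group (as a set of matrices): all `ω^λ P_{r,s}`. -/
def PauliSet1 : Set (Matrix (ZMod d) (ZMod d) ℂ) :=
  { M | ∃ lam r s : ZMod d, M = omega d ^ lam.val • Pauli d r s }

/-- The two-qudit Pauli group (as a set of matrices): all `ω^λ P_{r,s} ⊗ P_{r',s'}`. -/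
def PauliSet2 : Set (Matrix (ZMod d × ZMod d) (ZMod d × ZMod d) ℂ) :=
  { M | ∃ lam r s r' s' : ZMod d, M = omega d ^ lam.val • Pauli2 d r s r' s' }

/-- The one-qudit Clifford group: unitaries on `ℂ^d` normalizing the Pauli group. -/
def Cliff1 : Subgroup (Matrix.unitaryGroup (ZMod d) ℂ) where
  carrier := { U | ∀ M : Matrix (ZMod d) (ZMod d) ℂ,
      (U : Matrix (ZMod d) (ZMod d) ℂ) * M * star (U : Matrix (ZMod d) (ZMod d) ℂ) ∈ PauliSet1 d
        ↔ M ∈ PauliSet1 d }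
  one_mem' := by intro M; simp
  mul_mem' := by
    intro U V hU hV M
    have h : ((U * V : Matrix.unitaryGroup (ZMod d) ℂ) : Matrix (ZMod d) (ZMod d) ℂ) * M *
          star ((U * V : Matrix.unitaryGroup (ZMod d) ℂ) : Matrix (ZMod d) (ZMod d) ℂ)
        = (U : Matrix (ZMod d) (ZMod d) ℂ) *
            ((V : Matrix (ZMod d) (ZMod d) ℂ) * M * star (V : Matrix (ZMod d) (ZMod d) ℂ)) *
            star (U : Matrix (ZMod d) (ZMod d) ℂ) := by
      simp [Matrix.UnitaryGroup.mul_val, StarMul.star_mul, Matrix.mul_assoc]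
    rw [h]
    exact (hU _).trans (hV M)
  inv_mem' := by
    intro U hU M
    have h1 : (U : Matrix (ZMod d) (ZMod d) ℂ) * star (U : Matrix (ZMod d) (ZMod d) ℂ) = 1 :=
      U.2.2
    have h2 : star (U : Matrix (ZMod d) (ZMod d) ℂ) * (U : Matrix (ZMod d) (ZMod d) ℂ) = 1 :=
      U.2.1
    have key := hU (star (U : Matrix (ZMod d) (ZMod d) ℂ) * M * (U : Matrix (ZMod d) (ZMod d) ℂ))
    have h3 : (U : Matrix (ZMod d) (ZMod d) ℂ) *
          (star (U : Matrix (ZMod d) (ZMod d) ℂ) * M * (U : Matrix (ZMod d) (ZMod d) ℂ)) *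
          star (U : Matrix (ZMod d) (ZMod d) ℂ) = M := by
      rw [← Matrix.mul_assoc, ← Matrix.mul_assoc, h1, Matrix.one_mul, Matrix.mul_assoc, h1,
        Matrix.mul_one]
    rw [h3] at key
    simpa [Matrix.UnitaryGroup.inv_val, star_star] using key.symm

/-- The two-qudit Clifford group: unitaries on `ℂ^d ⊗ ℂ^d` normalizing the Pauli group. -/
def Cliff2 : Subgroup (Matrix.unitaryGroup (ZMod d × ZMod d) ℂ) where
  carrier := { U | ∀ M : Matrix (ZMod d × ZMod d) (ZMod d × ZMod d) ℂ,
      (U : Matrix (ZMod d × ZMod d) (ZMod d × ZMod d) ℂ) * M *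
          star (U : Matrix (ZMod d × ZMod d) (ZMod d × ZMod d) ℂ) ∈ PauliSet2 d
        ↔ M ∈ PauliSet2 d }
  one_mem' := by intro M; simp
  mul_mem' := by
    intro U V hU hV M
    have h : ((U * V : Matrix.unitaryGroup (ZMod d × ZMod d) ℂ) :
            Matrix (ZMod d × ZMod d) (ZMod d × ZMod d) ℂ) * M *
          star ((U * V : Matrix.unitaryGroup (ZMod d × ZMod d) ℂ) :
            Matrix (ZMod d × ZMod d) (ZMod d × ZMod d) ℂ)
        = (U : Matrix (ZMod d × ZMod d) (ZMod d × ZMod d) ℂ) *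
            ((V : Matrix (ZMod d × ZMod d) (ZMod d × ZMod d) ℂ) * M *
              star (V : Matrix (ZMod d × ZMod d) (ZMod d × ZMod d) ℂ)) *
            star (U : Matrix (ZMod d × ZMod d) (ZMod d × ZMod d) ℂ) := by
      simp [Matrix.UnitaryGroup.mul_val, StarMul.star_mul, Matrix.mul_assoc]
    rw [h]
    exact (hU _).trans (hV M)
  inv_mem' := by
    intro U hU M
    have h1 : (U : Matrix (ZMod d × ZMod d) (ZMod d × ZMod d) ℂ) *
        star (U : Matrix (ZMod d × ZMod d) (ZMod d × ZMod d) ℂ) = 1 := U.2.2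
    have key := hU (star (U : Matrix (ZMod d × ZMod d) (ZMod d × ZMod d) ℂ) * M *
      (U : Matrix (ZMod d × ZMod d) (ZMod d × ZMod d) ℂ))
    have h3 : (U : Matrix (ZMod d × ZMod d) (ZMod d × ZMod d) ℂ) *
          (star (U : Matrix (ZMod d × ZMod d) (ZMod d × ZMod d) ℂ) * M *
            (U : Matrix (ZMod d × ZMod d) (ZMod d × ZMod d) ℂ)) *
          star (U : Matrix (ZMod d × ZMod d) (ZMod d × ZMod d) ℂ) = M := by
      rw [← Matrix.mul_assoc, ← Matrix.mul_assoc, h1, Matrix.one_mul, Matrix.mul_assoc, h1,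
        Matrix.mul_one]
    rw [h3] at key
    simpa [Matrix.UnitaryGroup.inv_val, star_star] using key.symm

/-- The subgroup of `Cliff1 d` consisting of unit-modulus scalar multiples of the identity. -/
def scalarSubgroup1 : Subgroup (Cliff1 d) where
  carrier := { U | ∃ z : ℂ, ‖z‖ = 1 ∧
      ((U : Matrix.unitaryGroup (ZMod d) ℂ) : Matrix (ZMod d) (ZMod d) ℂ) = z • 1 }
  one_mem' := ⟨1, by simp⟩
  mul_mem' := by
    rintro U V ⟨z, hz, hU⟩ ⟨w, hw, hV⟩
    refine ⟨z * w, by simp [hz, hw], ?_⟩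
    show ((U : Matrix.unitaryGroup (ZMod d) ℂ) : Matrix (ZMod d) (ZMod d) ℂ) *
        ((V : Matrix.unitaryGroup (ZMod d) ℂ) : Matrix (ZMod d) (ZMod d) ℂ) = (z * w) • 1
    rw [hU, hV, Matrix.smul_mul, Matrix.mul_smul, Matrix.one_mul, smul_smul]
  inv_mem' := by
    rintro U ⟨z, hz, hU⟩
    refine ⟨starRingEnd ℂ z, by simp [hz], ?_⟩
    show star ((U : Matrix.unitaryGroup (ZMod d) ℂ) : Matrix (ZMod d) (ZMod d) ℂ) = _
    rw [hU, star_smul, star_one]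
    rfl

/-- The subgroup of `Cliff2 d` consisting of unit-modulus scalar multiples of the identity. -/
def scalarSubgroup2 : Subgroup (Cliff2 d) where
  carrier := { U | ∃ z : ℂ, ‖z‖ = 1 ∧
      ((U : Matrix.unitaryGroup (ZMod d × ZMod d) ℂ) :
        Matrix (ZMod d × ZMod d) (ZMod d × ZMod d) ℂ) = z • 1 }
  one_mem' := ⟨1, by simp⟩
  mul_mem' := by
    rintro U V ⟨z, hz, hU⟩ ⟨w, hw, hV⟩
    refine ⟨z * w, by simp [hz, hw], ?_⟩
    show ((U : Matrix.unitaryGroup (ZMod d × ZMod d) ℂ) :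
          Matrix (ZMod d × ZMod d) (ZMod d × ZMod d) ℂ) *
        ((V : Matrix.unitaryGroup (ZMod d × ZMod d) ℂ) :
          Matrix (ZMod d × ZMod d) (ZMod d × ZMod d) ℂ) = (z * w) • 1
    rw [hU, hV, Matrix.smul_mul, Matrix.mul_smul, Matrix.one_mul, smul_smul]
  inv_mem' := by
    rintro U ⟨z, hz, hU⟩
    refine ⟨starRingEnd ℂ z, by simp [hz], ?_⟩
    show star ((U : Matrix.unitaryGroup (ZMod d × ZMod d) ℂ) :
        Matrix (ZMod d × ZMod d) (ZMod d × ZMod d) ℂ) = _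
    rw [hU, star_smul, star_one]
    rfl

instance : (scalarSubgroup1 d).Normal := by
  constructor
  rintro n ⟨z, hz, hn⟩ g
  refine ⟨z, hz, ?_⟩
  show ((g : Matrix.unitaryGroup (ZMod d) ℂ) : Matrix (ZMod d) (ZMod d) ℂ) *
      ((n : Matrix.unitaryGroup (ZMod d) ℂ) : Matrix (ZMod d) (ZMod d) ℂ) *
      star ((g : Matrix.unitaryGroup (ZMod d) ℂ) : Matrix (ZMod d) (ZMod d) ℂ) = z • 1
  rw [hn, Matrix.mul_smul, Matrix.mul_one, Matrix.smul_mul]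
  congr 1
  exact (g : Matrix.unitaryGroup (ZMod d) ℂ).2.2

instance : (scalarSubgroup2 d).Normal := by
  constructor
  rintro n ⟨z, hz, hn⟩ g
  refine ⟨z, hz, ?_⟩
  show ((g : Matrix.unitaryGroup (ZMod d × ZMod d) ℂ) :
        Matrix (ZMod d × ZMod d) (ZMod d × ZMod d) ℂ) *
      ((n : Matrix.unitaryGroup (ZMod d × ZMod d) ℂ) :
        Matrix (ZMod d × ZMod d) (ZMod d × ZMod d) ℂ) *
      star ((g : Matrix.unitaryGroup (ZMod d × ZMod d) ℂ) :
        Matrix (ZMod d × ZMod d) (ZMod d × ZMod d) ℂ) = z • 1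
  rw [hn, Matrix.mul_smul, Matrix.mul_one, Matrix.smul_mul]
  congr 1
  exact (g : Matrix.unitaryGroup (ZMod d × ZMod d) ℂ).2.2

/-- The projective one-qudit Clifford group: `C_d^1` modulo unit-modulus scalar unitaries. -/
abbrev ProjCliff1 := Cliff1 d ⧸ scalarSubgroup1 d

/-- The projective two-qudit Clifford group: `C_d^2` modulo unit-modulus scalar unitaries. -/
abbrev ProjCliff2 := Cliff2 d ⧸ scalarSubgroup2 d

/-- The swap unitary matrix on `ℂ^d ⊗ ℂ^d`, acting as `u ⊗ v ↦ v ⊗ u`. -/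
def swapMat (d : ℕ) : Matrix (ZMod d × ZMod d) (ZMod d × ZMod d) ℂ :=
  Matrix.of fun p q => if p.1 = q.2 ∧ p.2 = q.1 then 1 else 0

theorem omega_pow_self : omega d ^ d = 1 := by
  rw [omega, ← Complex.exp_nat_mul, mul_div_cancel₀ _ (Nat.cast_ne_zero.mpr (NeZero.ne d)),
    Complex.exp_two_pi_mul_I]

theorem omega_pow_mod (n : ℕ) : omega d ^ (n % d) = omega d ^ n :=
  (pow_eq_pow_mod n (omega_pow_self d)).symm

theorem omega_pow_val_add (x y : ZMod d) :
    omega d ^ (x + y).val = omega d ^ x.val * omega d ^ y.val := by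
  rw [ZMod.val_add, omega_pow_mod, pow_add]

theorem Xmat_pow_apply (n : ℕ) (j k : ZMod d) :
    (Xmat d ^ n) j k = if k = j + n then 1 else 0 := by
  induction n generalizing j k with
  | zero => simp [Matrix.one_apply, eq_comm]
  | succ n ih =>
    rw [pow_succ, Matrix.mul_apply]
    simp only [ih, ite_mul, one_mul, zero_mul, Finset.sum_ite_eq',
      Finset.mem_univ, if_true]
    simp [Xmat, add_assoc]

theorem Zmat_pow (s : ZMod d) :
    Zmat d ^ s.val = Matrix.diagonal fun k => omega d ^ (s * k).val := by
  have h : Zmat d = Matrix.diagonal fun k => omega d ^ k.val := by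
    ext j k
    simp [Zmat, Matrix.diagonal_apply]
  rw [h, Matrix.diagonal_pow]
  congr 1
  funext k
  rw [Pi.pow_apply, ZMod.val_mul, omega_pow_mod, ← pow_mul, mul_comm]

theorem Pauli_apply (r s j k : ZMod d) :
    Pauli d r s j k = if k = j + r then omega d ^ (s * k).val else 0 := by
  rw [Pauli, Zmat_pow, Matrix.mul_diagonal, Xmat_pow_apply]
  simp

theorem Pauli2_apply (r s r' s' : ZMod d) (p q : ZMod d × ZMod d) :
    Pauli2 d r s r' s' p q = if q.1 = p.1 + r ∧ q.2 = p.2 + r' then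
      omega d ^ (s * q.1 + s' * q.2).val else 0 := by
  rw [Pauli2, Matrix.kroneckerMap_apply, Pauli_apply, Pauli_apply, omega_pow_val_add]
  split_ifs <;> simp_all

/-- The unitary matrix `∑ i, |i⟩⟨e i|` of a permutation `e`. -/
def permUnitary {ι : Type*} [Fintype ι] [DecidableEq ι] (e : ι ≃ ι) :
    Matrix.unitaryGroup ι ℂ :=
  ⟨(1 : Matrix ι ι ℂ).submatrix e id, by
    rw [Matrix.mem_unitaryGroup_iff, Matrix.star_eq_conjTranspose,
      Matrix.conjTranspose_submatrix, Matrix.conjTranspose_one]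
    ext i j
    simp [Matrix.mul_apply, Matrix.one_apply]⟩

theorem permUnitary_apply {ι : Type*} [Fintype ι] [DecidableEq ι] (e : ι ≃ ι) (i j : ι) :
    (permUnitary e : Matrix ι ι ℂ) i j = if e i = j then 1 else 0 := by
  simp [permUnitary, Matrix.one_apply]

theorem permUnitary_mul {ι : Type*} [Fintype ι] [DecidableEq ι] (e : ι ≃ ι) (M : Matrix ι ι ℂ) :
    (permUnitary e : Matrix ι ι ℂ) * M = M.submatrix e id := by
  ext i j
  simp [Matrix.mul_apply, permUnitary_apply]

theorem permUnitary_conj {ι : Type*} [Fintype ι] [DecidableEq ι] (e : ι ≃ ι)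
    (M : Matrix ι ι ℂ) :
    (permUnitary e : Matrix ι ι ℂ) * M * star (permUnitary e : Matrix ι ι ℂ)
      = M.submatrix e e := by
  rw [permUnitary_mul]
  ext i j
  simp [Matrix.mul_apply, permUnitary_apply, Matrix.star_apply, apply_ite (starRingEnd ℂ)]

theorem submatrix_neg_mem_PauliSet1 {M : Matrix (ZMod d) (ZMod d) ℂ} (hM : M ∈ PauliSet1 d) :
    M.submatrix (Equiv.neg _) (Equiv.neg _) ∈ PauliSet1 d := by
  obtain ⟨lam, r, s, rfl⟩ := hM
  refine ⟨lam, -r, -s, ?_⟩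
  ext j k
  have h : -k = -j + r ↔ k = j + -r := by
    rw [← neg_inj, neg_add, neg_neg, neg_neg]
  simp [Pauli_apply, h]

theorem permUnitary_neg_mem_Cliff1 : permUnitary (Equiv.neg (ZMod d)) ∈ Cliff1 d := by
  intro M
  rw [permUnitary_conj]
  refine ⟨fun h => ?_, submatrix_neg_mem_PauliSet1 d⟩
  simpa [Matrix.submatrix_submatrix, Function.comp_def] using submatrix_neg_mem_PauliSet1 d h

/-- The permutation `(a, b) ↦ (t (a + b), t (a - b))`, for `t` and `u` with `2 t u = 1`. -/
def sumDiffEquiv {R : Type*} [CommRing R] (t u : R) (h : 2 * (t * u) = 1) : R × R ≃ R × R where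
  toFun p := (t * (p.1 + p.2), t * (p.1 - p.2))
  invFun p := (u * (p.1 + p.2), u * (p.1 - p.2))
  left_inv p := by
    ext
    · linear_combination p.1 * h
    · linear_combination p.2 * h
  right_inv p := by
    ext
    · linear_combination p.1 * h
    · linear_combination p.2 * h

theorem submatrix_sumDiff_mem_PauliSet2 {t u : ZMod d} (h : 2 * (t * u) = 1)
    {M : Matrix (ZMod d × ZMod d) (ZMod d × ZMod d) ℂ} (hM : M ∈ PauliSet2 d) :
    M.submatrix (sumDiffEquiv t u h) (sumDiffEquiv t u h) ∈ PauliSet2 d := by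
  obtain ⟨lam, r, s, r', s', rfl⟩ := hM
  refine ⟨lam, u * (r + r'), t * (s + s'), u * (r - r'), t * (s - s'), ?_⟩
  ext ⟨a, b⟩ ⟨x, y⟩
  have hiff : (t * (x + y) = t * (a + b) + r ∧ t * (x - y) = t * (a - b) + r') ↔
      (x = a + u * (r + r') ∧ y = b + u * (r - r')) := by
    constructor
    · rintro ⟨h₁, h₂⟩
      constructor
      · linear_combination u * h₁ + u * h₂ + (a - x) * h
      · linear_combination u * h₁ - u * h₂ + (b - y) * h
    · rintro ⟨rfl, rfl⟩
      constructor
      · linear_combination r * h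
      · linear_combination r' * h
  have hexp : s * (t * (x + y)) + s' * (t * (x - y)) = t * (s + s') * x + t * (s - s') * y := by
    ring
  simp [Pauli2_apply, sumDiffEquiv, hiff, hexp]

theorem permUnitary_sumDiff_mem_Cliff2 {t u : ZMod d} (h : 2 * (t * u) = 1) :
    permUnitary (sumDiffEquiv t u h) ∈ Cliff2 d := by
  intro M
  rw [permUnitary_conj]
  refine ⟨fun hM => ?_, submatrix_sumDiff_mem_PauliSet2 d h⟩
  have h' : 2 * (u * t) = 1 := by rwa [mul_comm u]
  have hinv : ⇑(sumDiffEquiv u t h') = (sumDiffEquiv t u h).symm := rfl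
  simpa [Matrix.submatrix_submatrix, hinv] using submatrix_sumDiff_mem_PauliSet2 d h' hM

/-- For `d = 5`, there exist a two-qudit Clifford `C ∈ C_5^2` and one-qudit
Cliffords `C₁, C₂ ∈ C_5^1` such that `S C = C (C₁ ⊗ C₂)`, i.e. left multiplication by the swap
gate fixes the left coset `C · (C_5^1 ⊗ C_5^1)`. -/
theorem swap_fixes_local_clifford_coset :
    ∃ C : Matrix.unitaryGroup (ZMod 5 × ZMod 5) ℂ, C ∈ Cliff2 5 ∧
      ∃ C₁ C₂ : Matrix.unitaryGroup (ZMod 5) ℂ, C₁ ∈ Cliff1 5 ∧ C₂ ∈ Cliff1 5 ∧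
        swapMat 5 * (C : Matrix (ZMod 5 × ZMod 5) (ZMod 5 × ZMod 5) ℂ)
          = (C : Matrix (ZMod 5 × ZMod 5) (ZMod 5 × ZMod 5) ℂ) *
              ((C₁ : Matrix (ZMod 5) (ZMod 5) ℂ) ⊗ₖ (C₂ : Matrix (ZMod 5) (ZMod 5) ℂ)) := by
  refine ⟨permUnitary (sumDiffEquiv 1 3 (by decide)), permUnitary_sumDiff_mem_Cliff2 5 _,
    1, permUnitary (Equiv.neg _), one_mem _, permUnitary_neg_mem_Cliff1 5, ?_⟩
  have hswap : swapMat 5 = (permUnitary (Equiv.prodComm (ZMod 5) (ZMod 5)) : Matrix _ _ ℂ) := by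
    ext p q
    simp [swapMat, permUnitary_apply, Prod.ext_iff, and_comm]
  rw [hswap, permUnitary_mul, permUnitary_mul]
  ext ⟨a, b⟩ ⟨x, y⟩
  simp [permUnitary_apply, sumDiffEquiv, Matrix.one_apply, add_comm b a, ← ite_and, and_comm]
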